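/- Let f = 144(x⁴ + y⁴) − 225(x² + y²)z² + 350x²y² + 81z⁴ ∈ ℝ[x,y,z] (the Trott curve). Then V(f) is a smooth complex plane quartic, it has exactly 28 real bitangent lines, and every one of its bitangents is real and split with two distinct real tangency points. -/

import Mathlib

open MvPolynomial

noncomputable section

/-- Complexification of a real ternary polynomial. -/
def cmap (f : MvPolynomial (Fin 3) ℝ) : MvPolynomial (Fin 3) ℂ :=
  MvPolynomial.map (algebraMap ℝ ℂ) f

/-- Evaluation of the complexification of `f` at a complex point. -/
def cev (f : MvPolynomial (Fin 3) ℝ) (p : Fin 3 → ℂ) : ℂ :=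
  eval p (cmap f)

/-- The linear form with coefficient vector `ℓ`, evaluated at `p`. -/
def lin {R : Type*} [CommSemiring R] (ℓ p : Fin 3 → R) : R := ∑ i, ℓ i * p i

/-- The complexification of a real vector. -/
def cvec (v : Fin 3 → ℝ) : Fin 3 → ℂ := fun i => (v i : ℂ)

/-- Smoothness of the complex plane curve V(f): the gradient is nonzero at every
nonzero complex zero of `f`. -/
def SmoothQuartic (f : MvPolynomial (Fin 3) ℝ) : Prop :=
  ∀ p : Fin 3 → ℂ, p ≠ 0 → cev f p = 0 → ∃ i, eval p (pderiv i (cmap f)) ≠ 0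

/-- The line `V(ℓ)` is a bitangent of `V(f)` with tangency points `z₁, z₂`:
the restriction of `f` to the line is a nonzero scalar multiple of the square of a
nonzero quadratic form on the line, whose zeros (with multiplicity) are `z₁, z₂`.
Over ℂ the quadratic form is written as the product of two linear forms `m₁, m₂`,
each nonzero on the line and vanishing at the corresponding tangency point. -/
def IsBitangentAt (f : MvPolynomial (Fin 3) ℝ) (ℓ z₁ z₂ : Fin 3 → ℂ) : Prop :=
  ℓ ≠ 0 ∧ z₁ ≠ 0 ∧ z₂ ≠ 0 ∧ lin ℓ z₁ = 0 ∧ lin ℓ z₂ = 0 ∧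
  ∃ (m₁ m₂ : Fin 3 → ℂ) (c : ℂ), c ≠ 0 ∧
    lin m₁ z₁ = 0 ∧ lin m₂ z₂ = 0 ∧
    (∃ p, lin ℓ p = 0 ∧ lin m₁ p ≠ 0) ∧
    (∃ p, lin ℓ p = 0 ∧ lin m₂ p ≠ 0) ∧
    (∀ p, lin ℓ p = 0 → cev f p = c * (lin m₁ p * lin m₂ p) ^ 2)

/-- The line `V(ℓ)` is a bitangent of the quartic `V(f)`. -/
def IsBitangent (f : MvPolynomial (Fin 3) ℝ) (ℓ : Fin 3 → ℂ) : Prop :=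
  ∃ z₁ z₂, IsBitangentAt f ℓ z₁ z₂

/-- The set of real bitangent lines of `V(f)`, as points of the real projective
plane of lines. -/
def realBitangents (f : MvPolynomial (Fin 3) ℝ) :
    Set (Projectivization ℝ (Fin 3 → ℝ)) :=
  {L | IsBitangent f (cvec L.rep)}

/-- Directional derivative of (the complexification of) `f` along the real vector `v`. -/
def Dv (f : MvPolynomial (Fin 3) ℝ) (v : Fin 3 → ℝ) (z : Fin 3 → ℂ) : ℂ :=
  ∑ i, (v i : ℂ) * eval z (pderiv i (cmap f))

/-- `Qtype_{L∞}(L) = ε ∈ {+1, -1}` for the real bitangent `L = V(ℓ)` of `V(f)`,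
relative to the real line at infinity `V(ℓinf)`: for tangency points normalized so
that `ℓ∞(z̃ᵢ) = 1` and any real `v` with `ℓ(v) ≠ 0`, the product
`(D_v f)(z̃₁)·(D_v f)(z̃₂)` is a nonzero real number of sign `ε`. -/
def HasQtype (f : MvPolynomial (Fin 3) ℝ) (ℓinf : Fin 3 → ℝ) (ℓ : Fin 3 → ℂ)
    (ε : ℤ) : Prop :=
  ∃ (z₁ z₂ : Fin 3 → ℂ) (v : Fin 3 → ℝ) (r : ℝ),
    IsBitangentAt f ℓ z₁ z₂ ∧
    lin (cvec ℓinf) z₁ = 1 ∧ lin (cvec ℓinf) z₂ = 1 ∧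
    lin ℓ (cvec v) ≠ 0 ∧
    Dv f v z₁ * Dv f v z₂ = (r : ℂ) ∧
    ((0 < r ∧ ε = 1) ∨ (r < 0 ∧ ε = -1))

/-- A point of ℙ²(ℂ) (given by a nonzero vector) is real. -/
def IsRealPoint (z : Fin 3 → ℂ) : Prop :=
  ∃ (w : Fin 3 → ℝ) (t : ℂ), w ≠ 0 ∧ t ≠ 0 ∧ z = t • cvec w


/-- The Trott curve `144(x⁴ + y⁴) − 225(x² + y²)z² + 350x²y² + 81z⁴`. -/
def trott : MvPolynomial (Fin 3) ℝ :=
  C 144 * (X 0 ^ 4 + X 1 ^ 4) - C 225 * (X 0 ^ 2 + X 1 ^ 2) * X 2 ^ 2 +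
    C 350 * X 0 ^ 2 * X 1 ^ 2 + C 81 * X 2 ^ 4

theorem cev_trott (p : Fin 3 → ℂ) :
    cev trott p = 144 * (p 0 ^ 4 + p 1 ^ 4) - 225 * (p 0 ^ 2 + p 1 ^ 2) * p 2 ^ 2 +
      350 * p 0 ^ 2 * p 1 ^ 2 + 81 * p 2 ^ 4 := by
  simp [cev, cmap, trott]

theorem trott_isHomogeneous : trott.IsHomogeneous 4 := by
  have hX (i : Fin 3) (n : ℕ) : (X i ^ n : MvPolynomial (Fin 3) ℝ).IsHomogeneous n :=
    isHomogeneous_X_pow i n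
  have hC (c : ℝ) : (C c : MvPolynomial (Fin 3) ℝ).IsHomogeneous 0 := isHomogeneous_C _ c
  unfold trott
  refine ((IsHomogeneous.sub ?_ ?_).add ?_).add ?_
  · exact (hC 144).mul ((hX 0 4).add (hX 1 4))
  · exact ((hC 225).mul ((hX 0 2).add (hX 1 2))).mul (hX 2 2)
  · exact ((hC 350).mul (hX 0 2)).mul (hX 1 2)
  · exact (hC 81).mul (hX 2 4)

theorem smoothQuartic_trott : SmoothQuartic trott := by
  intro p hp _
  by_contra! h
  have h0 := h 0
  have h1 := h 1
  have h2 := h 2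
  simp [cmap, trott, Derivation.leibniz_pow, pderiv_X] at h0 h1 h2
  apply hp
  replace h0 : p 0 * (288 * p 0 ^ 2 + 350 * p 1 ^ 2 - 225 * p 2 ^ 2) = 0 := by
    linear_combination h0 / 2
  replace h1 : p 1 * (350 * p 0 ^ 2 + 288 * p 1 ^ 2 - 225 * p 2 ^ 2) = 0 := by
    linear_combination h1 / 2
  replace h2 : p 2 * (162 * p 2 ^ 2 - 225 * p 0 ^ 2 - 225 * p 1 ^ 2) = 0 := by
    linear_combination h2 / 2
  have key : p 0 ^ 2 = 0 ∧ p 1 ^ 2 = 0 ∧ p 2 ^ 2 = 0 := by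
    rcases mul_eq_zero.1 h0 with a | a <;> rcases mul_eq_zero.1 h1 with b | b <;>
      rcases mul_eq_zero.1 h2 with c | c <;> refine ⟨?_, ?_, ?_⟩ <;> grind
  funext i
  fin_cases i
  · simpa using key.1
  · simpa using key.2.1
  · simpa using key.2.2

theorem lin_add_smul {R : Type*} [CommRing R] (ℓ e₁ e₂ : Fin 3 → R) (x y : R) :
    lin ℓ (x • e₁ + y • e₂) = x * lin ℓ e₁ + y * lin ℓ e₂ := by
  simp [lin, Fin.sum_univ_three]
  ring

theorem lin_smul_right {R : Type*} [CommRing R] (ℓ p : Fin 3 → R) (t : R) :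
    lin ℓ (t • p) = t * lin ℓ p := by
  simp [lin, Fin.sum_univ_three]
  ring

theorem lin_smul_left {R : Type*} [CommRing R] (ℓ p : Fin 3 → R) (t : R) :
    lin (t • ℓ) p = t * lin ℓ p := by
  simp [lin, Fin.sum_univ_three]
  ring

theorem isBitangentAt_smul_iff {f : MvPolynomial (Fin 3) ℝ} {ℓ z₁ z₂ : Fin 3 → ℂ} {t : ℂ}
    (ht : t ≠ 0) : IsBitangentAt f (t • ℓ) z₁ z₂ ↔ IsBitangentAt f ℓ z₁ z₂ := by
  simp [IsBitangentAt, lin_smul_left, ht]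

theorem isBitangent_smul_iff {f : MvPolynomial (Fin 3) ℝ} {ℓ : Fin 3 → ℂ} {t : ℂ}
    (ht : t ≠ 0) : IsBitangent f (t • ℓ) ↔ IsBitangent f ℓ := by
  simp [IsBitangent, isBitangentAt_smul_iff ht]

/-- `e₁, e₂` is a basis of the plane `ℓ = 0`, with `n₁, n₂` extending the dual basis. -/
structure IsFrame (ℓ e₁ e₂ n₁ n₂ : Fin 3 → ℂ) : Prop where
  left : lin ℓ e₁ = 0
  right : lin ℓ e₂ = 0
  n₁e₁ : lin n₁ e₁ = 1
  n₁e₂ : lin n₁ e₂ = 0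
  n₂e₁ : lin n₂ e₁ = 0
  n₂e₂ : lin n₂ e₂ = 1
  span : ∀ p, lin ℓ p = 0 → p = lin n₁ p • e₁ + lin n₂ p • e₂

/-- The restriction of `f` to the plane spanned by `e₁, e₂` is the square of the binary form
`p x² + q x y + r y²`. -/
def IsSquareOn (f : MvPolynomial (Fin 3) ℝ) (e₁ e₂ : Fin 3 → ℂ) (p q r : ℂ) : Prop :=
  ∀ x y : ℂ, cev f (x • e₁ + y • e₂) = (p * x ^ 2 + q * x * y + r * y ^ 2) ^ 2

theorem IsBitangentAt.exists_isSquareOn {f : MvPolynomial (Fin 3) ℝ}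
    {ℓ z₁ z₂ e₁ e₂ n₁ n₂ : Fin 3 → ℂ} (h : IsBitangentAt f ℓ z₁ z₂)
    (hF : IsFrame ℓ e₁ e₂ n₁ n₂) :
    ∃ p q r : ℂ, IsSquareOn f e₁ e₂ p q r ∧
      (∀ z, z = z₁ ∨ z = z₂ → z ≠ 0 ∧ ∃ x y, z = x • e₁ + y • e₂ ∧
        p * x ^ 2 + q * x * y + r * y ^ 2 = 0) ∧
      (q ^ 2 - 4 * p * r ≠ 0 → ¬ ∃ t : ℂ, z₂ = t • z₁) := by
  obtain ⟨-, hz₁, hz₂, hl₁, hl₂, m₁, m₂, c, hc, hm₁, hm₂, -, -, hf⟩ := h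
  obtain ⟨s, rfl⟩ : ∃ s, c = s ^ 2 := by
    obtain ⟨s, hs⟩ := IsAlgClosed.exists_pow_nat_eq c two_pos
    exact ⟨s, hs.symm⟩
  have e₁' := hF.span z₁ hl₁
  have e₂' := hF.span z₂ hl₂
  generalize lin n₁ z₁ = x₁ at e₁'
  generalize lin n₂ z₁ = y₁ at e₁'
  generalize lin n₁ z₂ = x₂ at e₂'
  generalize lin n₂ z₂ = y₂ at e₂'
  refine ⟨s * lin m₁ e₁ * lin m₂ e₁,
    s * (lin m₁ e₁ * lin m₂ e₂ + lin m₁ e₂ * lin m₂ e₁),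
    s * lin m₁ e₂ * lin m₂ e₂, ?_, ?_, ?_⟩
  · intro x y
    rw [hf _ (by rw [lin_add_smul, hF.left, hF.right]; ring), lin_add_smul, lin_add_smul]
    ring
  · rintro z (rfl | rfl)
    · refine ⟨hz₁, x₁, y₁, e₁', ?_⟩
      rw [e₁', lin_add_smul] at hm₁
      linear_combination (s * (x₁ * lin m₂ e₁ + y₁ * lin m₂ e₂)) * hm₁
    · refine ⟨hz₂, x₂, y₂, e₂', ?_⟩
      rw [e₂', lin_add_smul] at hm₂
      linear_combination (s * (x₂ * lin m₁ e₁ + y₂ * lin m₁ e₂)) * hm₂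
  · rintro hd ⟨t, ht⟩
    have ht0 : t ≠ 0 := by rintro rfl; exact hz₂ (by simp [ht])
    rw [ht, lin_smul_right, mul_eq_zero, or_iff_right ht0] at hm₂
    rw [e₁', lin_add_smul] at hm₁ hm₂
    have hdet : lin m₁ e₁ * lin m₂ e₂ - lin m₁ e₂ * lin m₂ e₁ ≠ 0 := by
      intro h0
      apply hd
      linear_combination
        s ^ 2 * (lin m₁ e₁ * lin m₂ e₂ - lin m₁ e₂ * lin m₂ e₁) * h0
    have hx : x₁ = 0 := by
      apply (mul_eq_zero.1 (_ : (lin m₁ e₁ * lin m₂ e₂ - lin m₁ e₂ * lin m₂ e₁) * x₁ = 0)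
        ).resolve_left hdet
      linear_combination lin m₂ e₂ * hm₁ - lin m₁ e₂ * hm₂
    have hy : y₁ = 0 := by
      apply (mul_eq_zero.1 (_ : (lin m₁ e₁ * lin m₂ e₂ - lin m₁ e₂ * lin m₂ e₁) * y₁ = 0)
        ).resolve_left hdet
      linear_combination lin m₁ e₁ * hm₂ - lin m₂ e₁ * hm₁
    apply hz₁
    rw [e₁', hx, hy]
    simp

theorem IsSquareOn.isBitangent {f : MvPolynomial (Fin 3) ℝ} {ℓ e₁ e₂ n₁ n₂ : Fin 3 → ℂ}
    {p q r : ℂ} (h : IsSquareOn f e₁ e₂ p q r) (hℓ : ℓ ≠ 0) (hF : IsFrame ℓ e₁ e₂ n₁ n₂)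
    (hp : p ≠ 0) : IsBitangent f ℓ := by
  obtain ⟨d, hd⟩ : ∃ d, d ^ 2 = q ^ 2 - 4 * p * r := IsAlgClosed.exists_pow_nat_eq _ two_pos
  have key (ρ : ℂ) : ρ • e₁ + (1 : ℂ) • e₂ ≠ 0 ∧ lin ℓ (ρ • e₁ + (1 : ℂ) • e₂) = 0 ∧
      lin ((1 : ℂ) • n₁ + (-ρ) • n₂) (ρ • e₁ + (1 : ℂ) • e₂) = 0 ∧
      ∃ p, lin ℓ p = 0 ∧ lin ((1 : ℂ) • n₁ + (-ρ) • n₂) p ≠ 0 := by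
    have hadd (p : Fin 3 → ℂ) : lin ((1 : ℂ) • n₁ + (-ρ) • n₂) p = lin n₁ p - ρ * lin n₂ p := by
      simp [lin, Fin.sum_univ_three]
      ring
    refine ⟨?_, ?_, ?_, e₁, hF.left, ?_⟩
    · intro h0
      have := congrArg (lin n₂) h0
      rw [lin_add_smul, hF.n₂e₁, hF.n₂e₂] at this
      simp [lin] at this
    · rw [lin_add_smul, hF.left, hF.right]; ring
    · rw [hadd, lin_add_smul, lin_add_smul, hF.n₁e₁, hF.n₁e₂, hF.n₂e₁, hF.n₂e₂]; ring
    · rw [hadd, hF.n₁e₁, hF.n₂e₁]; simp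
  obtain ⟨a₁, a₂, a₃, a₄⟩ := key ((-q + d) / (2 * p))
  obtain ⟨b₁, b₂, b₃, b₄⟩ := key ((-q - d) / (2 * p))
  refine ⟨_, _, hℓ, a₁, b₁, a₂, b₂, _, _, p ^ 2, pow_ne_zero 2 hp, a₃, b₃, a₄, b₄, ?_⟩
  intro z hz
  have hz' := h (lin n₁ z) (lin n₂ z)
  rw [← hF.span z hz] at hz'
  rw [hz', ← mul_pow]
  have hadd (ρ : ℂ) : lin ((1 : ℂ) • n₁ + (-ρ) • n₂) z = lin n₁ z - ρ * lin n₂ z := by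
    simp [lin, Fin.sum_univ_three]
    ring
  rw [hadd, hadd]
  congr 1
  field_simp
  linear_combination lin n₂ z ^ 2 * hd

theorem binary_quartic_eq_sq {A₀ A₁ A₂ A₃ A₄ p q r : ℂ}
    (h : ∀ x y : ℂ, A₀ * x ^ 4 + A₁ * x ^ 3 * y + A₂ * x ^ 2 * y ^ 2 + A₃ * x * y ^ 3 +
      A₄ * y ^ 4 = (p * x ^ 2 + q * x * y + r * y ^ 2) ^ 2) :
    A₀ = p ^ 2 ∧ A₁ = 2 * p * q ∧ A₂ = q ^ 2 + 2 * p * r ∧ A₃ = 2 * q * r ∧ A₄ = r ^ 2 := by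
  have a := h 1 0
  have b := h 0 1
  have c := h 1 1
  have d := h 1 (-1)
  have e := h 1 2
  refine ⟨?_, ?_, ?_, ?_, ?_⟩
  · linear_combination a
  · linear_combination -a / 2 + 2 * b + c - d / 3 - e / 6
  · linear_combination -a - b + c / 2 + d / 2
  · linear_combination a / 2 - 2 * b - c / 2 - d / 6 + e / 6
  · linear_combination b

theorem exists_real_direction {P Q R : ℝ} {x y : ℂ} (hd : 0 < Q ^ 2 - 4 * P * R)
    (hxy : x ≠ 0 ∨ y ≠ 0) (h : (P : ℂ) * x ^ 2 + Q * x * y + R * y ^ 2 = 0) :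
    ∃ (a b : ℝ) (t : ℂ), t ≠ 0 ∧ x = t * a ∧ y = t * b := by
  by_cases hP : P = 0
  · subst hP
    have hQ : Q ≠ 0 := by rintro rfl; simp at hd
    have hQ' : (Q : ℂ) ≠ 0 := by exact_mod_cast hQ
    by_cases hy : y = 0
    · exact ⟨1, 0, x, hxy.resolve_right (not_not.2 hy), by simp, by simp [hy]⟩
    · refine ⟨-R / Q, 1, y, hy, ?_, by simp⟩
      have : y * (Q * x + R * y) = 0 := by push_cast at h; linear_combination h
      have := (mul_eq_zero.1 this).resolve_left hy
      push_cast
      field_simp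
      linear_combination this
  · have hP' : (P : ℂ) ≠ 0 := by exact_mod_cast hP
    have hy : y ≠ 0 := by
      rintro rfl
      have : x = 0 := by simpa [hP] using h
      simp [this] at hxy
    have hs : ((Real.sqrt (Q ^ 2 - 4 * P * R) : ℝ) : ℂ) ^ 2 = Q ^ 2 - 4 * P * R := by
      exact_mod_cast Real.sq_sqrt hd.le
    have : (2 * P * x + Q * y) ^ 2 = (Real.sqrt (Q ^ 2 - 4 * P * R) * y) ^ 2 := by
      rw [mul_pow, hs]
      linear_combination 4 * (P : ℂ) * h
    rcases sq_eq_sq_iff_eq_or_eq_neg.1 this with h' | h'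
    · refine ⟨(-Q + Real.sqrt (Q ^ 2 - 4 * P * R)) / (2 * P), 1, y, hy, ?_, by simp⟩
      push_cast
      field_simp
      linear_combination h'
    · refine ⟨(-Q - Real.sqrt (Q ^ 2 - 4 * P * R)) / (2 * P), 1, y, hy, ?_, by simp⟩
      push_cast
      field_simp
      linear_combination h'

theorem isRealPoint_of_mem_plane {e₁ e₂ : Fin 3 → ℝ} {z : Fin 3 → ℂ} {P Q R : ℝ} {x y : ℂ}
    (hd : 0 < Q ^ 2 - 4 * P * R) (hz : z ≠ 0) (hzxy : z = x • cvec e₁ + y • cvec e₂)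
    (h : (P : ℂ) * x ^ 2 + Q * x * y + R * y ^ 2 = 0) : IsRealPoint z := by
  have hxy : x ≠ 0 ∨ y ≠ 0 := by
    by_contra! h0
    apply hz
    simp [hzxy, h0]
  obtain ⟨a, b, t, ht, rfl, rfl⟩ := exists_real_direction hd hxy h
  have hzt : z = t • cvec (a • e₁ + b • e₂) := by
    rw [hzxy]
    funext i
    simp [cvec]
    ring
  refine ⟨_, t, ?_, ht, hzt⟩
  intro h0
  apply hz
  rw [hzt, h0]
  funext i
  simp [cvec]

/-- A tangency form which becomes real with positive discriminant after scaling by `k` has two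
distinct real zeros. -/
theorem real_tangency_of_discrim_pos {e₁ e₂ : Fin 3 → ℝ} {z₁ z₂ : Fin 3 → ℂ} {p q r k : ℂ}
    {P Q R : ℝ} (hP : k * p = P) (hQ : k * q = Q) (hR : k * r = R)
    (hd : 0 < Q ^ 2 - 4 * P * R)
    (hz : ∀ z, z = z₁ ∨ z = z₂ → z ≠ 0 ∧ ∃ x y, z = x • cvec e₁ + y • cvec e₂ ∧
        p * x ^ 2 + q * x * y + r * y ^ 2 = 0)
    (hne : q ^ 2 - 4 * p * r ≠ 0 → ¬ ∃ t : ℂ, z₂ = t • z₁) :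
    IsRealPoint z₁ ∧ IsRealPoint z₂ ∧ ¬ ∃ t : ℂ, z₂ = t • z₁ := by
  have key (z : Fin 3 → ℂ) (h : z = z₁ ∨ z = z₂) : IsRealPoint z := by
    obtain ⟨hz0, x, y, hxy, h0⟩ := hz z h
    refine isRealPoint_of_mem_plane hd hz0 hxy ?_
    rw [← hP, ← hQ, ← hR]
    linear_combination k * h0
  refine ⟨key z₁ (.inl rfl), key z₂ (.inr rfl), hne fun h0 => hd.ne' ?_⟩
  have : ((Q ^ 2 - 4 * P * R : ℝ) : ℂ) = 0 := by
    push_cast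
    rw [← hP, ← hQ, ← hR]
    linear_combination k ^ 2 * h0
  exact_mod_cast this

theorem exists_biquadratic_roots {A B C : ℝ} (hA : 0 < A) (hB : 0 < B) (hC : 0 < C)
    (hd : 0 < B ^ 2 - 4 * A * C) :
    ∃ a b : ℝ, 0 < a ∧ a < b ∧ A * (a ^ 2 + b ^ 2) = B ∧ A * (a ^ 2 * b ^ 2) = C := by
  have hs := Real.sq_sqrt hd.le
  have hs0 := Real.sqrt_pos.2 hd
  set s := Real.sqrt (B ^ 2 - 4 * A * C)
  have hsB : s < B := by nlinarith [mul_pos hA hC]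
  have h₁ : 0 < (B - s) / (2 * A) := div_pos (by linarith) (by linarith)
  have h₂ : (B - s) / (2 * A) < (B + s) / (2 * A) := by gcongr; linarith
  refine ⟨Real.sqrt ((B - s) / (2 * A)), Real.sqrt ((B + s) / (2 * A)), Real.sqrt_pos.2 h₁,
    Real.sqrt_lt_sqrt h₁.le h₂, ?_, ?_⟩
  · rw [Real.sq_sqrt h₁.le, Real.sq_sqrt (h₁.trans h₂).le]
    field_simp
    ring
  · rw [Real.sq_sqrt h₁.le, Real.sq_sqrt (h₁.trans h₂).le]
    field_simp
    linear_combination -hs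

theorem biquadratic_eq_zero_iff {K : Type*} [Field K] {A B C a b u : K} (hA : A ≠ 0)
    (hB : A * (a ^ 2 + b ^ 2) = B) (hC : A * (a ^ 2 * b ^ 2) = C) :
    A * u ^ 4 - B * u ^ 2 + C = 0 ↔ u ^ 2 = a ^ 2 ∨ u ^ 2 = b ^ 2 := by
  have : A * u ^ 4 - B * u ^ 2 + C = A * (u ^ 2 - a ^ 2) * (u ^ 2 - b ^ 2) := by
    rw [← hB, ← hC]
    ring
  rw [this, mul_eq_zero, mul_eq_zero, or_iff_right hA, sub_eq_zero, sub_eq_zero]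

theorem exists_real_of_biquadratic {A B C : ℝ} {u : ℂ} (hA : 0 < A) (hB : 0 < B) (hC : 0 < C)
    (hd : 0 < B ^ 2 - 4 * A * C) (h : (A : ℂ) * u ^ 4 - B * u ^ 2 + C = 0) :
    ∃ w : ℝ, u = w := by
  obtain ⟨a, b, -, -, h₁, h₂⟩ := exists_biquadratic_roots hA hB hC hd
  have := (biquadratic_eq_zero_iff (a := (a : ℂ)) (b := b) (by exact_mod_cast hA.ne')
    (by exact_mod_cast h₁) (by exact_mod_cast h₂)).1 h
  rcases this with h | h <;> rcases sq_eq_sq_iff_eq_or_eq_neg.1 h with rfl | rfl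
  · exact ⟨a, rfl⟩
  · exact ⟨-a, by simp⟩
  · exact ⟨b, rfl⟩
  · exact ⟨-b, by simp⟩

/-- The pairs `(u, v)` for which the line `z = u x + v y` is a bitangent of the Trott curve. -/
def affineLocus (K : Type*) [Field K] : Set (K × K) :=
  {w | (w.1 ^ 2 = w.2 ^ 2 ∧ 117 * w.1 ^ 4 - 1550 * w.1 ^ 2 + 992 = 0) ∨
    (9 * (w.1 ^ 2 + w.2 ^ 2) = 25 ∧ 279 * (w.1 ^ 2 * w.2 ^ 2) = 104) ∨
    (w.2 = 0 ∧ 3969 * w.1 ^ 4 - 27900 * w.1 ^ 2 + 39556 = 0) ∨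
    (w.1 = 0 ∧ 3969 * w.2 ^ 4 - 27900 * w.2 ^ 2 + 39556 = 0)}

/-- The `t` for which the line `x = t y` is a bitangent of the Trott curve. -/
def centralLocus (K : Type*) [Field K] : Set K :=
  {t | 49 * t ^ 4 - 150 * t ^ 2 + 49 = 0}

theorem ofReal_mem_affineLocus_iff {a b : ℝ} :
    ((a : ℂ), (b : ℂ)) ∈ affineLocus ℂ ↔ (a, b) ∈ affineLocus ℝ := by
  simp only [affineLocus, Set.mem_ofPred_eq]
  norm_cast

theorem ofReal_mem_centralLocus_iff {a : ℝ} :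
    (a : ℂ) ∈ centralLocus ℂ ↔ a ∈ centralLocus ℝ := by
  simp only [centralLocus, Set.mem_ofPred_eq]
  norm_cast

theorem exists_real_of_mem_affineLocus {u v : ℂ} (h : (u, v) ∈ affineLocus ℂ) :
    ∃ a b : ℝ, u = a ∧ v = b ∧ (a, b) ∈ affineLocus ℝ := by
  have key : (∃ a : ℝ, u = a) ∧ ∃ b : ℝ, v = b := by
    rcases h with ⟨h₁, h₂⟩ | ⟨h₁, h₂⟩ | ⟨h₁, h₂⟩ | ⟨h₁, h₂⟩ <;> dsimp only at h₁ h₂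
    · constructor <;>
        refine exists_real_of_biquadratic (A := 117) (B := 1550) (C := 992) (by norm_num)
          (by norm_num) (by norm_num) (by norm_num) ?_ <;> push_cast
      · exact h₂
      · linear_combination h₂ + (1550 - 117 * (u ^ 2 + v ^ 2)) * h₁
    · constructor <;>
        refine exists_real_of_biquadratic (A := 279) (B := 775) (C := 104) (by norm_num)
          (by norm_num) (by norm_num) (by norm_num) ?_ <;> push_cast
      · linear_combination 31 * u ^ 2 * h₁ - h₂
      · linear_combination 31 * v ^ 2 * h₁ - h₂
    · refine ⟨exists_real_of_biquadratic (A := 3969) (B := 27900) (C := 39556) (by norm_num)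
        (by norm_num) (by norm_num) (by norm_num) ?_, 0, by simp [h₁]⟩
      exact_mod_cast h₂
    · refine ⟨⟨0, by simp [h₁]⟩, exists_real_of_biquadratic (A := 3969) (B := 27900)
        (C := 39556) (by norm_num) (by norm_num) (by norm_num) (by norm_num) ?_⟩
      exact_mod_cast h₂
  obtain ⟨⟨a, rfl⟩, b, rfl⟩ := key
  exact ⟨a, b, rfl, rfl, ofReal_mem_affineLocus_iff.1 h⟩

theorem exists_real_of_mem_centralLocus {t : ℂ} (h : t ∈ centralLocus ℂ) :
    ∃ a : ℝ, t = a ∧ a ∈ centralLocus ℝ := by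
  obtain ⟨a, rfl⟩ := exists_real_of_biquadratic (A := 49) (B := 150) (C := 49) (u := t)
    (by norm_num) (by norm_num) (by norm_num) (by norm_num) (by exact_mod_cast h)
  exact ⟨a, rfl, ofReal_mem_centralLocus_iff.1 h⟩

theorem isFrame_affine (u v : ℂ) :
    IsFrame ![u, v, -1] ![1, 0, u] ![0, 1, v] ![1, 0, 0] ![0, 1, 0] := by
  constructor <;> simp [lin, Fin.sum_univ_three]
  intro p h
  funext i
  fin_cases i <;> simp
  linear_combination -h

theorem isFrame_central (t : ℂ) :
    IsFrame ![1, -t, 0] ![t, 1, 0] ![0, 0, 1] ![0, 1, 0] ![0, 0, 1] := by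
  constructor <;> simp [lin, Fin.sum_univ_three]
  intro p h
  funext i
  fin_cases i <;> simp
  linear_combination h

theorem isFrame_horizontal :
    IsFrame ![0, 1, 0] ![1, 0, 0] ![0, 0, 1] ![1, 0, 0] ![0, 0, 1] := by
  constructor <;> simp [lin, Fin.sum_univ_three]
  intro p h
  funext i
  fin_cases i <;> simp [h]

theorem isSquareOn_affine_iff {u v p q r : ℂ} :
    IsSquareOn trott ![1, 0, u] ![0, 1, v] p q r ↔
      144 - 225 * u ^ 2 + 81 * u ^ 4 = p ^ 2 ∧
      18 * u * v * (18 * u ^ 2 - 25) = 2 * p * q ∧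
      350 - 225 * (u ^ 2 + v ^ 2) + 486 * u ^ 2 * v ^ 2 = q ^ 2 + 2 * p * r ∧
      18 * u * v * (18 * v ^ 2 - 25) = 2 * q * r ∧
      144 - 225 * v ^ 2 + 81 * v ^ 4 = r ^ 2 := by
  simp only [IsSquareOn, cev_trott]
  constructor
  · intro h
    apply binary_quartic_eq_sq
    intro x y
    rw [← h x y]
    simp
    ring
  · rintro ⟨h₀, h₁, h₂, h₃, h₄⟩ x y
    simp
    linear_combination x ^ 4 * h₀ + x ^ 3 * y * h₁ + x ^ 2 * y ^ 2 * h₂ + x * y ^ 3 * h₃ +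
      y ^ 4 * h₄

theorem isSquareOn_central_iff {t p q r : ℂ} :
    IsSquareOn trott ![t, 1, 0] ![0, 0, 1] p q r ↔
      144 * t ^ 4 + 350 * t ^ 2 + 144 = p ^ 2 ∧ 0 = 2 * p * q ∧
      -225 * (t ^ 2 + 1) = q ^ 2 + 2 * p * r ∧ 0 = 2 * q * r ∧ 81 = r ^ 2 := by
  simp only [IsSquareOn, cev_trott]
  constructor
  · intro h
    apply binary_quartic_eq_sq
    intro x y
    rw [← h x y]
    simp
    ring
  · rintro ⟨h₀, h₁, h₂, h₃, h₄⟩ x y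
    simp
    linear_combination x ^ 4 * h₀ + x ^ 3 * y * h₁ + x ^ 2 * y ^ 2 * h₂ + x * y ^ 3 * h₃ +
      y ^ 4 * h₄

theorem not_isSquareOn_horizontal {p q r : ℂ} :
    ¬ IsSquareOn trott ![1, 0, 0] ![0, 0, 1] p q r := by
  simp only [IsSquareOn, cev_trott]
  intro h
  obtain ⟨h₀, h₁, h₂, h₃, h₄⟩ := binary_quartic_eq_sq (A₀ := 144) (A₁ := 0) (A₂ := -225)
    (A₃ := 0) (A₄ := 81) (p := p) (q := q) (r := r) (by
      intro x y
      rw [← h x y]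
      simp
      ring)
  have hr : r ≠ 0 := by rintro rfl; norm_num at h₄
  have hq : q = 0 := by simpa [hr] using h₃.symm
  subst hq
  have : (3969 : ℂ) = 0 := by
    linear_combination (-225 + 2 * p * r) * h₂ - 4 * 81 * h₀ - 4 * p ^ 2 * h₄
  norm_num at this

theorem affine_square_cases {u v p q r : ℂ}
    (h : IsSquareOn trott ![1, 0, u] ![0, 1, v] p q r) :
    (u ^ 2 = v ^ 2 ∧ 117 * u ^ 4 - 1550 * u ^ 2 + 992 = 0 ∧ r = p) ∨
    (9 * (u ^ 2 + v ^ 2) = 25 ∧ 279 * (u ^ 2 * v ^ 2) = 104 ∧ r = -p) ∨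
    (v = 0 ∧ 3969 * u ^ 4 - 27900 * u ^ 2 + 39556 = 0 ∧ q = 0) ∨
    (u = 0 ∧ 3969 * v ^ 4 - 27900 * v ^ 2 + 39556 = 0 ∧ q = 0) := by
  obtain ⟨h₀, h₁, h₂, h₃, h₄⟩ := isSquareOn_affine_iff.1 h
  by_cases hv : v = 0
  · subst hv
    right; right; left
    have hr : r ≠ 0 := by rintro rfl; norm_num at h₄
    have hq : q = 0 := by simpa [hr] using h₃.symm
    subst hq
    refine ⟨rfl, ?_, rfl⟩
    linear_combination (350 - 225 * u ^ 2 + 2 * p * r) * h₂ - 4 * 144 * h₀ - 4 * p ^ 2 * h₄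
  by_cases hu : u = 0
  · subst hu
    right; right; right
    have hp : p ≠ 0 := by rintro rfl; norm_num at h₀
    have hq : q = 0 := by simpa [hp] using h₁.symm
    subst hq
    refine ⟨rfl, ?_, rfl⟩
    linear_combination (350 - 225 * v ^ 2 + 2 * p * r) * h₂ - 4 * 144 * h₄ - 4 * r ^ 2 * h₀
  have huv : u * v ≠ 0 := mul_ne_zero hu hv
  have hpr : r ^ 2 = p ^ 2 := by
    have : (u * v) ^ 2 * (r ^ 2 - p ^ 2) = 0 := by
      have e : (18 * u * v * (18 * u ^ 2 - 25)) ^ 2 * r ^ 2 =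
          (18 * u * v * (18 * v ^ 2 - 25)) ^ 2 * p ^ 2 := by
        rw [h₁, h₃]; ring
      linear_combination e / 15876 - (4 / 49) * (u * v) ^ 2 * r ^ 2 * h₀ +
        (4 / 49) * (u * v) ^ 2 * p ^ 2 * h₄
    exact sub_eq_zero.1 ((mul_eq_zero.1 this).resolve_left (pow_ne_zero 2 huv))
  have hsq : (9 * u * v * (18 * u ^ 2 - 25)) ^ 2 = p ^ 2 * q ^ 2 := by
    linear_combination (9 * u * v * (18 * u ^ 2 - 25) / 2 + p * q / 2) * h₁
  rcases sq_eq_sq_iff_eq_or_eq_neg.1 hpr with rfl | rfl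
  · left
    have hUV : u ^ 2 = v ^ 2 := by
      apply mul_left_cancel₀ huv
      linear_combination h₁ / 324 - h₃ / 324
    refine ⟨hUV, ?_, rfl⟩
    have hp : r ^ 2 = 144 - 225 * u ^ 2 + 81 * u ^ 4 := h₀.symm
    have hq : q ^ 2 = 350 - 450 * u ^ 2 + 486 * u ^ 4 - 2 * r ^ 2 := by
      linear_combination -h₂ - (486 * u ^ 2 - 225) * hUV
    rw [hq, hp, mul_pow, mul_pow, mul_pow, ← hUV] at hsq
    linear_combination -hsq / 9
  · right; left
    have hUV : 9 * (u ^ 2 + v ^ 2) = 25 := by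
      apply mul_left_cancel₀ huv
      linear_combination h₁ / 36 + h₃ / 36
    refine ⟨hUV, ?_, rfl⟩
    have hv2 : v ^ 2 = 25 / 9 - u ^ 2 := by linear_combination hUV / 9
    have hp : p ^ 2 = 144 - 225 * u ^ 2 + 81 * u ^ 4 := h₀.symm
    have hq : q ^ 2 = -275 + 486 * u ^ 2 * (25 / 9 - u ^ 2) + 2 * p ^ 2 := by
      linear_combination -h₂ + (486 * u ^ 2 - 225) * hv2
    rw [hq, hp, mul_pow, mul_pow, mul_pow, hv2] at hsq
    rw [hv2]
    linear_combination hsq / 18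

theorem exists_affine_square {u v : ℂ} (h : (u, v) ∈ affineLocus ℂ) :
    ∃ p q r : ℂ, p ≠ 0 ∧ IsSquareOn trott ![1, 0, u] ![0, 1, v] p q r := by
  obtain ⟨p, hp⟩ : ∃ p, p ^ 2 = 144 - 225 * u ^ 2 + 81 * u ^ 4 :=
    IsAlgClosed.exists_pow_nat_eq _ two_pos
  simp only [isSquareOn_affine_iff]
  rcases h with ⟨h₁, h₂⟩ | ⟨h₁, h₂⟩ | ⟨h₁, h₂⟩ | ⟨h₁, h₂⟩ <;> dsimp only at h₁ h₂
  · have hp' : 62 * p ^ 2 = 3969 * u ^ 4 := by linear_combination 62 * hp + 9 * h₂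
    have hp0 : p ≠ 0 := by
      rintro rfl
      have : u = 0 := by simpa using hp'
      norm_num [this] at h₂
    refine ⟨p, 9 * u * v * (18 * u ^ 2 - 25) / p, p, hp0, hp.symm, by field_simp; ring, ?_, ?_, ?_⟩
    · have : (9 * u * v * (18 * u ^ 2 - 25)) ^ 2 =
          (350 - 450 * u ^ 2 + 486 * u ^ 4 - 2 * p ^ 2) * p ^ 2 := by
        rw [mul_pow, mul_pow, mul_pow, ← h₁, hp]
        linear_combination -9 * h₂
      rw [div_pow, this]
      field_simp
      linear_combination (225 - 486 * u ^ 2) * h₁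
    · field_simp
      linear_combination -324 * u * v * h₁
    · linear_combination -hp + (225 - 81 * (u ^ 2 + v ^ 2)) * h₁
  · have hv2 : v ^ 2 = 25 / 9 - u ^ 2 := by linear_combination h₁ / 9
    have hp' : 279 * p ^ 2 = 31752 := by
      rw [hv2] at h₂
      linear_combination 279 * hp - 81 * h₂
    have hp0 : p ≠ 0 := by
      rintro rfl
      norm_num at hp'
    refine ⟨p, 9 * u * v * (18 * u ^ 2 - 25) / p, -p, hp0, hp.symm, by field_simp; ring, ?_, ?_, ?_⟩
    · have : (9 * u * v * (18 * u ^ 2 - 25)) ^ 2 =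
          (-275 + 486 * u ^ 2 * (25 / 9 - u ^ 2) + 2 * p ^ 2) * p ^ 2 := by
        rw [hv2] at h₂
        rw [mul_pow, mul_pow, mul_pow, hv2, hp]
        linear_combination 18 * h₂
      rw [div_pow, this]
      field_simp
      linear_combination 9 * (486 * u ^ 2 - 225) * hv2
    · field_simp
      linear_combination 36 * u * v * h₁
    · linear_combination -hp + (81 * (v ^ 2 - u ^ 2) / 9) * h₁
  · subst h₁
    have hp' : 4 * 144 * p ^ 2 = (350 - 225 * u ^ 2) ^ 2 := by
      linear_combination 4 * 144 * hp - h₂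
    have hp0 : p ≠ 0 := by
      rintro rfl
      have : 350 - 225 * u ^ 2 = 0 := pow_eq_zero_iff two_ne_zero |>.1 (by linear_combination -hp')
      have : (5760 : ℂ) = 0 := by
        linear_combination h₂ + (3969 * u ^ 2 - 21726) / 225 * this
      norm_num at this
    refine ⟨p, 0, (350 - 225 * u ^ 2) / (2 * p), hp0, hp.symm, by ring, ?_, by ring, ?_⟩
    · field_simp
      ring
    · rw [div_pow, ← hp']
      field_simp
      ring
  · subst h₁
    refine ⟨12, 0, (350 - 225 * v ^ 2) / 24, by norm_num, by norm_num, by ring, by ring, by ring,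
      ?_⟩
    linear_combination -h₂ / 576

theorem exists_central_square {t : ℂ} (h : t ∈ centralLocus ℂ) :
    ∃ p q r : ℂ, p ≠ 0 ∧ IsSquareOn trott ![t, 1, 0] ![0, 0, 1] p q r := by
  simp only [isSquareOn_central_iff]
  simp only [centralLocus, Set.mem_ofPred_eq] at h
  refine ⟨-25 / 2 * (t ^ 2 + 1), 0, 9, ?_, ?_, by ring, by ring, by ring, by norm_num⟩
  · intro h0
    have : (248 : ℂ) = 0 := by
      linear_combination h + (2 / 25) * (49 * t ^ 2 - 199) * h0
    norm_num at this
  · linear_combination -h / 4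

theorem isBitangent_affine_iff {u v : ℂ} :
    IsBitangent trott ![u, v, -1] ↔ (u, v) ∈ affineLocus ℂ := by
  constructor
  · rintro ⟨z₁, z₂, h⟩
    obtain ⟨p, q, r, hs, -, -⟩ := h.exists_isSquareOn (isFrame_affine u v)
    rcases affine_square_cases hs with h | h | h | h
    · exact .inl ⟨h.1, h.2.1⟩
    · exact .inr (.inl ⟨h.1, h.2.1⟩)
    · exact .inr (.inr (.inl ⟨h.1, h.2.1⟩))
    · exact .inr (.inr (.inr ⟨h.1, h.2.1⟩))
  · intro h
    obtain ⟨p, q, r, hp, hs⟩ := exists_affine_square h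
    exact hs.isBitangent (fun h0 => by simpa using congrFun h0 2) (isFrame_affine u v) hp

theorem isBitangent_central_iff {t : ℂ} :
    IsBitangent trott ![1, -t, 0] ↔ t ∈ centralLocus ℂ := by
  constructor
  · rintro ⟨z₁, z₂, h⟩
    obtain ⟨p, q, r, hs, -, -⟩ := h.exists_isSquareOn (isFrame_central t)
    obtain ⟨h₀, h₁, h₂, h₃, h₄⟩ := isSquareOn_central_iff.1 hs
    have hr : r ≠ 0 := by rintro rfl; norm_num at h₄
    have hq : q = 0 := by simpa [hr] using h₃.symm
    subst hq
    simp only [centralLocus, Set.mem_ofPred_eq]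
    linear_combination ((-225 * (t ^ 2 + 1) + 2 * p * r) * h₂ - 4 * 81 * h₀ -
      4 * p ^ 2 * h₄) / 81
  · intro h
    obtain ⟨p, q, r, hp, hs⟩ := exists_central_square h
    exact hs.isBitangent (fun h0 => by simpa using congrFun h0 0) (isFrame_central t) hp

theorem not_isBitangent_horizontal : ¬ IsBitangent trott ![0, 1, 0] := by
  rintro ⟨z₁, z₂, h⟩
  obtain ⟨p, q, r, hs, -, -⟩ := h.exists_isSquareOn isFrame_horizontal
  exact not_isSquareOn_horizontal hs

theorem real_tangency_affine {u v : ℂ} {z₁ z₂ : Fin 3 → ℂ}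
    (h : IsBitangentAt trott ![u, v, -1] z₁ z₂) :
    IsRealPoint z₁ ∧ IsRealPoint z₂ ∧ ¬ ∃ t : ℂ, z₂ = t • z₁ := by
  obtain ⟨a, b, rfl, rfl, -⟩ := exists_real_of_mem_affineLocus
    (isBitangent_affine_iff.1 ⟨z₁, z₂, h⟩)
  obtain ⟨p, q, r, hs, hz, hne⟩ := h.exists_isSquareOn (isFrame_affine a b)
  have e₁ : ![1, 0, (a : ℂ)] = cvec ![1, 0, a] := by
    funext i
    fin_cases i <;> simp [cvec]
  have e₂ : ![0, 1, (b : ℂ)] = cvec ![0, 1, b] := by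
    funext i
    fin_cases i <;> simp [cvec]
  rw [e₁, e₂] at hz
  have hp : p * p = ((144 - 225 * a ^ 2 + 81 * a ^ 4 : ℝ) : ℂ) := by
    push_cast
    linear_combination -(isSquareOn_affine_iff.1 hs).1
  have hpq : p * q = ((9 * a * b * (18 * a ^ 2 - 25) : ℝ) : ℂ) := by
    push_cast
    linear_combination -(isSquareOn_affine_iff.1 hs).2.1 / 2
  have hmid := (isSquareOn_affine_iff.1 hs).2.2.1
  have hlast := (isSquareOn_affine_iff.1 hs).2.2.2.2
  rcases affine_square_cases hs with ⟨h₁, h₂, rfl⟩ | ⟨h₁, h₂, rfl⟩ | ⟨h₁, h₂, rfl⟩ |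
    ⟨h₁, h₂, rfl⟩ <;> norm_cast at h₁ h₂
  · refine real_tangency_of_discrim_pos hp hpq hp ?_ hz hne
    have hP : 62 * (144 - 225 * a ^ 2 + 81 * a ^ 4) = 3969 * a ^ 4 := by
      linear_combination 9 * h₂
    have ha : a ≠ 0 := by rintro rfl; norm_num at h₂
    have hP' : 144 - 225 * a ^ 2 + 81 * a ^ 4 = 3969 * a ^ 4 / 62 := by linear_combination hP / 62
    have hQ : (9 * a * b * (18 * a ^ 2 - 25)) ^ 2 =
        81 * a ^ 4 * (4 * (144 - 225 * a ^ 2 + 81 * a ^ 4) + 49) := by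
      rw [mul_pow, mul_pow, mul_pow, ← h₁]
      ring
    have : (9 * a * b * (18 * a ^ 2 - 25)) ^ 2 - 4 * (144 - 225 * a ^ 2 + 81 * a ^ 4) *
        (144 - 225 * a ^ 2 + 81 * a ^ 4) = 3969 * a ^ 4 / 62 * (2106 / 31 * a ^ 4 + 62) := by
      rw [hQ, hP']
      ring
    rw [this]
    positivity
  · refine real_tangency_of_discrim_pos hp hpq
      (R := -(144 - 225 * a ^ 2 + 81 * a ^ 4)) (by rw [mul_neg, hp]; push_cast; rfl) ?_ hz hne
    have hb2 : b ^ 2 = 25 / 9 - a ^ 2 := by linear_combination h₁ / 9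
    have hP : 144 - 225 * a ^ 2 + 81 * a ^ 4 = 3528 / 31 := by
      rw [hb2] at h₂
      linear_combination -81 / 279 * h₂
    rw [hP]
    nlinarith [sq_nonneg (9 * a * b * (18 * a ^ 2 - 25))]
  · refine real_tangency_of_discrim_pos (k := r) (P := (350 - 225 * a ^ 2) / 2) (Q := 0)
      (R := 144) ?_ (by simp) ?_ ?_ hz hne
    · push_cast
      simp only [h₁] at hmid
      push_cast at hmid
      linear_combination -hmid / 2
    · simp only [h₁] at hlast
      push_cast at hlast ⊢
      linear_combination -hlast
    · nlinarith [sq_nonneg (a ^ 2 - 14 / 9)]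
  · refine real_tangency_of_discrim_pos (k := p) (P := 144) (Q := 0)
      (R := (350 - 225 * b ^ 2) / 2) ?_ (by simp) ?_ ?_ hz hne
    · rw [hp, h₁]
      norm_num
    · push_cast
      simp only [h₁] at hmid
      push_cast at hmid
      linear_combination -hmid / 2
    · nlinarith [sq_nonneg (b ^ 2 - 14 / 9)]

theorem real_tangency_central {t : ℂ} {z₁ z₂ : Fin 3 → ℂ}
    (h : IsBitangentAt trott ![1, -t, 0] z₁ z₂) :
    IsRealPoint z₁ ∧ IsRealPoint z₂ ∧ ¬ ∃ t : ℂ, z₂ = t • z₁ := by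
  obtain ⟨a, rfl, -⟩ := exists_real_of_mem_centralLocus
    (isBitangent_central_iff.1 ⟨z₁, z₂, h⟩)
  obtain ⟨p, q, r, hs, hz, hne⟩ := h.exists_isSquareOn (isFrame_central a)
  have e₁ : ![(a : ℂ), 1, 0] = cvec ![a, 1, 0] := by
    funext i
    fin_cases i <;> simp [cvec]
  have e₂ : ![0, 0, (1 : ℂ)] = cvec ![0, 0, 1] := by
    funext i
    fin_cases i <;> simp [cvec]
  rw [e₁, e₂] at hz
  obtain ⟨h₀, h₁, h₂, h₃, h₄⟩ := isSquareOn_central_iff.1 hs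
  have hr : r ≠ 0 := by rintro rfl; norm_num at h₄
  have hq : q = 0 := by simpa [hr] using h₃.symm
  subst hq
  refine real_tangency_of_discrim_pos (k := r) (P := -225 * (a ^ 2 + 1) / 2) (Q := 0) (R := 81)
    ?_ (by simp) ?_ ?_ hz hne
  · push_cast
    linear_combination -h₂ / 2
  · push_cast
    linear_combination -h₄
  · nlinarith [sq_nonneg a]

theorem exists_normal_form {K : Type*} [Field K] {ℓ : Fin 3 → K} (h : ℓ ≠ 0) :
    ∃ t : K, t ≠ 0 ∧ ((∃ u v, ℓ = t • ![u, v, -1]) ∨ (∃ s, ℓ = t • ![1, -s, 0]) ∨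
      ℓ = t • ![0, 1, 0]) := by
  by_cases h₂ : ℓ 2 = 0
  · by_cases h₀ : ℓ 0 = 0
    · by_cases h₁ : ℓ 1 = 0
      · exact absurd (by funext i; fin_cases i <;> simp [h₀, h₁, h₂]) h
      · refine ⟨ℓ 1, h₁, .inr (.inr ?_)⟩
        funext i
        fin_cases i <;> simp [h₀, h₂]
    · refine ⟨ℓ 0, h₀, .inr (.inl ⟨-ℓ 1 / ℓ 0, ?_⟩)⟩
      funext i
      fin_cases i <;> simp [h₂]
      field_simp
  · refine ⟨-ℓ 2, neg_ne_zero.2 h₂, .inl ⟨-ℓ 0 / ℓ 2, -ℓ 1 / ℓ 2, ?_⟩⟩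
    funext i
    fin_cases i <;> simp <;> field_simp

theorem real_of_isBitangent {ℓ : Fin 3 → ℂ} (h : IsBitangent trott ℓ) :
    ∃ (w : Fin 3 → ℝ) (t : ℂ), w ≠ 0 ∧ t ≠ 0 ∧ ℓ = t • cvec w := by
  have hℓ : ℓ ≠ 0 := by
    obtain ⟨_, _, h⟩ := h
    exact h.1
  obtain ⟨t, ht, ⟨u, v, rfl⟩ | ⟨s, rfl⟩ | rfl⟩ := exists_normal_form hℓ <;>
    rw [isBitangent_smul_iff ht] at h
  · obtain ⟨a, b, rfl, rfl, -⟩ := exists_real_of_mem_affineLocus (isBitangent_affine_iff.1 h)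
    refine ⟨![a, b, -1], t, fun h0 => by simpa using congrFun h0 2, ht, ?_⟩
    congr 1
    funext i
    fin_cases i <;> simp [cvec]
  · obtain ⟨a, rfl, -⟩ := exists_real_of_mem_centralLocus (isBitangent_central_iff.1 h)
    refine ⟨![1, -a, 0], t, fun h0 => by simpa using congrFun h0 0, ht, ?_⟩
    congr 1
    funext i
    fin_cases i <;> simp [cvec]
  · exact absurd h not_isBitangent_horizontal

theorem real_tangency {ℓ z₁ z₂ : Fin 3 → ℂ} (h : IsBitangentAt trott ℓ z₁ z₂) :
    IsRealPoint z₁ ∧ IsRealPoint z₂ ∧ ¬ ∃ t : ℂ, z₂ = t • z₁ := by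
  obtain ⟨t, ht, ⟨u, v, rfl⟩ | ⟨s, rfl⟩ | rfl⟩ := exists_normal_form h.1 <;>
    rw [isBitangentAt_smul_iff ht] at h
  · exact real_tangency_affine h
  · exact real_tangency_central h
  · exact absurd ⟨z₁, z₂, h⟩ not_isBitangent_horizontal

theorem ncard_setOf_sq_eq_sq {a : ℝ} (ha : a ≠ 0) : {u : ℝ | u ^ 2 = a ^ 2}.ncard = 2 := by
  have : {u : ℝ | u ^ 2 = a ^ 2} = {a, -a} := by
    ext u
    simp [sq_eq_sq_iff_eq_or_eq_neg]
  rw [this, Set.ncard_pair]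
  intro h
  exact ha (by linarith)

theorem finite_setOf_sq_eq_sq (a : ℝ) : {u : ℝ | u ^ 2 = a ^ 2}.Finite := by
  have : {u : ℝ | u ^ 2 = a ^ 2} = {a, -a} := by
    ext u
    simp [sq_eq_sq_iff_eq_or_eq_neg]
  rw [this]
  exact Set.toFinite _

theorem ncard_setOf_biquadratic {A B C : ℝ} (hA : 0 < A) (hB : 0 < B) (hC : 0 < C)
    (hd : 0 < B ^ 2 - 4 * A * C) : {u : ℝ | A * u ^ 4 - B * u ^ 2 + C = 0}.ncard = 4 := by
  obtain ⟨a, b, ha, hab, h₁, h₂⟩ := exists_biquadratic_roots hA hB hC hd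
  have : {u : ℝ | A * u ^ 4 - B * u ^ 2 + C = 0} =
      {u : ℝ | u ^ 2 = a ^ 2} ∪ {u : ℝ | u ^ 2 = b ^ 2} := by
    ext u
    exact biquadratic_eq_zero_iff hA.ne' h₁ h₂
  rw [this, Set.ncard_union_eq _ (finite_setOf_sq_eq_sq a) (finite_setOf_sq_eq_sq b),
    ncard_setOf_sq_eq_sq ha.ne', ncard_setOf_sq_eq_sq (ha.trans hab).ne']
  rw [Set.disjoint_left]
  intro u (hu : u ^ 2 = a ^ 2) (hu' : u ^ 2 = b ^ 2)
  nlinarith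

theorem finite_of_ncard_eq_succ {α : Type*} {s : Set α} {n : ℕ} (h : s.ncard = n + 1) :
    s.Finite :=
  Set.finite_of_ncard_ne_zero (by omega)

theorem ncard_prod_setOf_sq {a b : ℝ} (ha : a ≠ 0) (hb : b ≠ 0) :
    ({u : ℝ | u ^ 2 = a ^ 2} ×ˢ {v : ℝ | v ^ 2 = b ^ 2}).ncard = 4 := by
  rw [Set.ncard_prod, ncard_setOf_sq_eq_sq ha, ncard_setOf_sq_eq_sq hb]

theorem ncard_union_of_ncard {α : Type*} {s t : Set α} {m n : ℕ} (hs : s.ncard = m + 1)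
    (ht : t.ncard = n + 1) (hd : ∀ x ∈ s, x ∉ t) : (s ∪ t).ncard = m + n + 1 + 1 := by
  rw [Set.ncard_union_eq (Set.disjoint_left.2 fun x => hd x) (finite_of_ncard_eq_succ hs)
    (finite_of_ncard_eq_succ ht), hs, ht]
  omega

theorem add_eq_and_mul_eq_iff {K : Type*} [Field K] {x y b c : K} :
    (x + y = b + c ∧ x * y = b * c) ↔ (x = b ∧ y = c) ∨ (x = c ∧ y = b) := by
  constructor
  · rintro ⟨h₁, h₂⟩
    have : (x - b) * (x - c) = 0 := by linear_combination x * h₁ - h₂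
    rcases mul_eq_zero.1 this with h | h
    · exact .inl ⟨by linear_combination h, by linear_combination h₁ - h⟩
    · exact .inr ⟨by linear_combination h, by linear_combination h₁ - h⟩
  · rintro (⟨rfl, rfl⟩ | ⟨rfl, rfl⟩)
    · exact ⟨rfl, rfl⟩
    · exact ⟨add_comm _ _, mul_comm _ _⟩

theorem ncard_diagonal_affine :
    {w : ℝ × ℝ | w.1 ^ 2 = w.2 ^ 2 ∧ 117 * w.1 ^ 4 - 1550 * w.1 ^ 2 + 992 = 0}.ncard = 8 := by
  obtain ⟨a, b, ha, hab, h₁, h₂⟩ := exists_biquadratic_roots (A := 117) (B := 1550)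
    (C := 992) (by norm_num) (by norm_num) (by norm_num) (by norm_num)
  have hne : a ^ 2 ≠ b ^ 2 := by
    have : a ^ 2 < b ^ 2 := by gcongr
    exact this.ne
  have : {w : ℝ × ℝ | w.1 ^ 2 = w.2 ^ 2 ∧ 117 * w.1 ^ 4 - 1550 * w.1 ^ 2 + 992 = 0} =
      {u : ℝ | u ^ 2 = a ^ 2} ×ˢ {v : ℝ | v ^ 2 = a ^ 2} ∪
      {u : ℝ | u ^ 2 = b ^ 2} ×ˢ {v : ℝ | v ^ 2 = b ^ 2} := by
    ext ⟨u, v⟩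
    simp only [Set.mem_ofPred_eq, Set.mem_union, Set.mem_prod,
      biquadratic_eq_zero_iff (u := u) (by norm_num) h₁ h₂]
    constructor
    · rintro ⟨h, h' | h'⟩
      · exact .inl ⟨h', h.symm.trans h'⟩
      · exact .inr ⟨h', h.symm.trans h'⟩
    · rintro (⟨h, h'⟩ | ⟨h, h'⟩)
      · exact ⟨h.trans h'.symm, .inl h⟩
      · exact ⟨h.trans h'.symm, .inr h⟩
  rw [this]
  refine ncard_union_of_ncard (ncard_prod_setOf_sq ha.ne' ha.ne')
    (ncard_prod_setOf_sq (ha.trans hab).ne' (ha.trans hab).ne') ?_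
  rintro w ⟨hw, -⟩ ⟨hw', -⟩
  exact hne (hw.symm.trans hw')

theorem ncard_offDiagonal_affine :
    {w : ℝ × ℝ | 9 * (w.1 ^ 2 + w.2 ^ 2) = 25 ∧ 279 * (w.1 ^ 2 * w.2 ^ 2) = 104}.ncard = 8 := by
  obtain ⟨a, b, ha, hab, h₁, h₂⟩ := exists_biquadratic_roots (A := 279) (B := 775)
    (C := 104) (by norm_num) (by norm_num) (by norm_num) (by norm_num)
  have hne : a ^ 2 ≠ b ^ 2 := by
    have : a ^ 2 < b ^ 2 := by gcongr
    exact this.ne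
  have : {w : ℝ × ℝ | 9 * (w.1 ^ 2 + w.2 ^ 2) = 25 ∧ 279 * (w.1 ^ 2 * w.2 ^ 2) = 104} =
      {u : ℝ | u ^ 2 = a ^ 2} ×ˢ {v : ℝ | v ^ 2 = b ^ 2} ∪
      {u : ℝ | u ^ 2 = b ^ 2} ×ˢ {v : ℝ | v ^ 2 = a ^ 2} := by
    ext ⟨u, v⟩
    simp only [Set.mem_ofPred_eq, Set.mem_union, Set.mem_prod, ← add_eq_and_mul_eq_iff]
    constructor <;> rintro ⟨h, h'⟩ <;> constructor <;> linarith
  rw [this]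
  refine ncard_union_of_ncard (ncard_prod_setOf_sq ha.ne' (ha.trans hab).ne')
    (ncard_prod_setOf_sq (ha.trans hab).ne' ha.ne') ?_
  rintro w ⟨hw, -⟩ ⟨hw', -⟩
  exact hne (hw.symm.trans hw')

theorem ncard_axis_affine :
    {w : ℝ × ℝ | (w.2 = 0 ∧ 3969 * w.1 ^ 4 - 27900 * w.1 ^ 2 + 39556 = 0) ∨
      (w.1 = 0 ∧ 3969 * w.2 ^ 4 - 27900 * w.2 ^ 2 + 39556 = 0)}.ncard = 8 := by
  have hD := ncard_setOf_biquadratic (A := 3969) (B := 27900) (C := 39556) (by norm_num)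
    (by norm_num) (by norm_num) (by norm_num)
  set D : Set ℝ := {u | 3969 * u ^ 4 - 27900 * u ^ 2 + 39556 = 0}
  have : {w : ℝ × ℝ | (w.2 = 0 ∧ 3969 * w.1 ^ 4 - 27900 * w.1 ^ 2 + 39556 = 0) ∨
      (w.1 = 0 ∧ 3969 * w.2 ^ 4 - 27900 * w.2 ^ 2 + 39556 = 0)} = D ×ˢ {0} ∪ {0} ×ˢ D := by
    ext ⟨u, v⟩
    exact or_congr and_comm Iff.rfl
  rw [this]
  refine ncard_union_of_ncard (m := 3) (n := 3) (by simp [Set.ncard_prod, hD])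
    (by simp [Set.ncard_prod, hD]) ?_
  rintro ⟨u, v⟩ ⟨hu, -⟩ ⟨rfl, -⟩
  norm_num [D] at hu

theorem ncard_affineLocus : (affineLocus ℝ).ncard = 24 := by
  refine ncard_union_of_ncard ncard_diagonal_affine
    (ncard_union_of_ncard ncard_offDiagonal_affine ncard_axis_affine ?_) ?_
  · rintro ⟨u, v⟩ ⟨-, h⟩ (⟨rfl, -⟩ | ⟨rfl, -⟩) <;> norm_num at h
  · rintro ⟨u, v⟩ ⟨h, h'⟩ (⟨h₁, h₂⟩ | ⟨h₁, h₂⟩ | ⟨h₁, h₂⟩) <;>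
      dsimp only at h h' h₁ h₂
    · rw [← h] at h₁ h₂
      have hu : u ^ 2 = 25 / 18 := by linarith
      norm_num [hu] at h₂
    · subst h₁
      have hu : u = 0 := by simpa using h
      norm_num [hu] at h'
    · norm_num [h₁] at h'

theorem ncard_centralLocus : (centralLocus ℝ).ncard = 4 :=
  ncard_setOf_biquadratic (by norm_num) (by norm_num) (by norm_num) (by norm_num)

/-- The class of the line `z = u x + v y`. -/
def affineLine (w : ℝ × ℝ) : Projectivization ℝ (Fin 3 → ℝ) :=
  .mk ℝ ![w.1, w.2, -1] fun h => by simpa using congrFun h 2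

/-- The class of the line `x = t y`. -/
def centralLine (t : ℝ) : Projectivization ℝ (Fin 3 → ℝ) :=
  .mk ℝ ![1, -t, 0] fun h => by simpa using congrFun h 0

theorem affineLine_injective : Function.Injective affineLine := by
  rintro ⟨u, v⟩ ⟨u', v'⟩ h
  obtain ⟨a, ha⟩ := (Projectivization.mk_eq_mk_iff' _ _ _ _ _).1 h
  have h₂ := congrFun ha 2
  have h₀ := congrFun ha 0
  have h₁ := congrFun ha 1
  simp at h₀ h₁ h₂
  subst h₂
  simp_all

theorem centralLine_injective : Function.Injective centralLine := by
  intro t t' h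
  obtain ⟨a, ha⟩ := (Projectivization.mk_eq_mk_iff' _ _ _ _ _).1 h
  have h₀ := congrFun ha 0
  have h₁ := congrFun ha 1
  simp at h₀ h₁
  subst h₀
  simpa using h₁.symm

theorem affineLine_ne_centralLine (w : ℝ × ℝ) (t : ℝ) : affineLine w ≠ centralLine t := by
  intro h
  obtain ⟨a, ha⟩ := (Projectivization.mk_eq_mk_iff' _ _ _ _ _).1 h
  simpa using congrFun ha 2

theorem cvec_smul (t : ℝ) (v : Fin 3 → ℝ) : cvec (t • v) = (t : ℂ) • cvec v := by
  funext i
  simp [cvec]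

theorem mk_mem_realBitangents_iff {f : MvPolynomial (Fin 3) ℝ} {v : Fin 3 → ℝ} (hv : v ≠ 0) :
    Projectivization.mk ℝ v hv ∈ realBitangents f ↔ IsBitangent f (cvec v) := by
  obtain ⟨a, ha⟩ := Projectivization.exists_smul_eq_mk_rep ℝ v hv
  change IsBitangent f (cvec (Projectivization.mk ℝ v hv).rep) ↔ _
  rw [← ha, Units.smul_def, cvec_smul,
    isBitangent_smul_iff (Complex.ofReal_ne_zero.2 a.ne_zero)]

theorem affineLine_mem_realBitangents_iff {w : ℝ × ℝ} :
    affineLine w ∈ realBitangents trott ↔ w ∈ affineLocus ℝ := by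
  rw [affineLine, mk_mem_realBitangents_iff, ← ofReal_mem_affineLocus_iff,
    ← isBitangent_affine_iff]
  have : cvec ![w.1, w.2, -1] = ![(w.1 : ℂ), (w.2 : ℂ), -1] := by
    funext i
    fin_cases i <;> simp [cvec]
  rw [this]

theorem centralLine_mem_realBitangents_iff {t : ℝ} :
    centralLine t ∈ realBitangents trott ↔ t ∈ centralLocus ℝ := by
  rw [centralLine, mk_mem_realBitangents_iff, ← ofReal_mem_centralLocus_iff,
    ← isBitangent_central_iff]
  have : cvec ![1, -t, 0] = ![1, -(t : ℂ), 0] := by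
    funext i
    fin_cases i <;> simp [cvec]
  rw [this]

theorem realBitangents_trott :
    realBitangents trott = affineLine '' affineLocus ℝ ∪ centralLine '' centralLocus ℝ := by
  ext L
  constructor
  · intro hL
    induction L using Projectivization.ind with
    | h v hv =>
      obtain ⟨t, ht, ⟨u, w, rfl⟩ | ⟨s, rfl⟩ | rfl⟩ := exists_normal_form hv
      · have e : affineLine (u, w) = .mk ℝ (t • ![u, w, -1]) hv :=
          (Projectivization.mk_eq_mk_iff' _ _ _ _ _).2 ⟨t⁻¹, inv_smul_smul₀ ht _⟩
        exact .inl ⟨(u, w), affineLine_mem_realBitangents_iff.1 (e ▸ hL), e⟩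
      · have e : centralLine s = .mk ℝ (t • ![1, -s, 0]) hv :=
          (Projectivization.mk_eq_mk_iff' _ _ _ _ _).2 ⟨t⁻¹, inv_smul_smul₀ ht _⟩
        exact .inr ⟨s, centralLine_mem_realBitangents_iff.1 (e ▸ hL), e⟩
      · rw [mk_mem_realBitangents_iff, cvec_smul,
          isBitangent_smul_iff (Complex.ofReal_ne_zero.2 ht)] at hL
        have e : cvec ![0, 1, 0] = ![0, 1, 0] := by
          funext i
          fin_cases i <;> simp [cvec]
        exact absurd (e ▸ hL) not_isBitangent_horizontal
  · rintro (⟨w, hw, rfl⟩ | ⟨t, ht, rfl⟩)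
    · exact affineLine_mem_realBitangents_iff.2 hw
    · exact centralLine_mem_realBitangents_iff.2 ht

theorem ncard_realBitangents_trott : (realBitangents trott).ncard = 28 := by
  rw [realBitangents_trott]
  refine ncard_union_of_ncard (m := 23) (n := 3) ?_ ?_ ?_
  · rw [Set.ncard_image_of_injective _ affineLine_injective, ncard_affineLocus]
  · rw [Set.ncard_image_of_injective _ centralLine_injective, ncard_centralLocus]
  · rintro _ ⟨w, -, rfl⟩ ⟨t, -, h⟩
    exact affineLine_ne_centralLine w t h.symm

/-- The Trott curve is a smooth plane quartic, it has exactly 28 real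
bitangent lines, and every one of its (complex) bitangents is real and split with two
distinct real tangency points. -/
theorem statement12 :
    trott.IsHomogeneous 4 ∧
    SmoothQuartic trott ∧
    (realBitangents trott).ncard = 28 ∧
    (∀ ℓ : Fin 3 → ℂ, IsBitangent trott ℓ →
      ∃ (w : Fin 3 → ℝ) (t : ℂ), w ≠ 0 ∧ t ≠ 0 ∧ ℓ = t • cvec w) ∧
    (∀ (ℓ z₁ z₂ : Fin 3 → ℂ), IsBitangentAt trott ℓ z₁ z₂ →
      IsRealPoint z₁ ∧ IsRealPoint z₂ ∧ ¬ ∃ t : ℂ, z₂ = t • z₁) := by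
  exact ⟨trott_isHomogeneous, smoothQuartic_trott, ncard_realBitangents_trott,
    fun _ => real_of_isBitangent, fun _ _ _ => real_tangency⟩

end
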